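/- arXiv:1811.08689 — 5 statements merged into one kernel-verified Lean document; each statement's English description precedes it below -/
import Mathlib

section
/- Let S, T, P be Cu-semigroups, let (f_λ)_λ be a path in Cu[S,T] and (g_λ)_λ a path in Cu[T,P]. Then (g_λ ∘ f_λ)_λ is a path in Cu[S,P]. Moreover, if (f_λ) ∼ (f'_λ) in Cu[S,T] and (g_λ) ∼ (g'_λ) in Cu[T,P], then (g_λ ∘ f_λ) ∼ (g'_λ ∘ f'_λ); hence the assignment ([g],[f]) ↦ [g]∘[f] := [(g_λ ∘ f_λ)_λ] is a well-defined Cu-bimorphism ⟦T,P⟧ × ⟦S,T⟧ → ⟦S,P⟧. -/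
/-! ### Abstract Cuntz semigroups: basic framework -/

/-- The way-below (compact containment) relation. -/
def WayBelow {S : Type*} [Preorder S] (a b : S) : Prop :=
  ∀ c : ℕ → S, Monotone c → ∀ s : S, IsLUB (Set.range c) s → b ≤ s → ∃ n, a ≤ c n

/-- A `Cu`-semigroup (abstract Cuntz semigroup): a positively ordered monoid
satisfying the axioms (O1)-(O4). -/
class CuSemigroup (S : Type*) [AddCommMonoid S] [PartialOrder S] : Prop where
  add_le_add' : ∀ a b c d : S, a ≤ b → c ≤ d → a + c ≤ b + d
  zero_le' : ∀ a : S, (0 : S) ≤ a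
  O1 : ∀ c : ℕ → S, Monotone c → ∃ s : S, IsLUB (Set.range c) s
  O2 : ∀ a : S, ∃ c : ℕ → S, (∀ n, WayBelow (c n) (c (n + 1))) ∧ IsLUB (Set.range c) a
  O3 : ∀ a' a b' b : S, WayBelow a' a → WayBelow b' b → WayBelow (a' + b') (a + b)
  O4 : ∀ (c d : ℕ → S) (s t : S), Monotone c → Monotone d →
      IsLUB (Set.range c) s → IsLUB (Set.range d) t →
      IsLUB (Set.range (fun n => c n + d n)) (s + t)

section WayBelowBasic

variable {S : Type*} [Preorder S]

theorem WayBelow.le {a b : S} (h : WayBelow a b) : a ≤ b := by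
  obtain ⟨n, hn⟩ := h (fun _ => b) monotone_const b
    (by rw [Set.range_const]; exact isLUB_singleton) le_rfl
  exact hn

theorem WayBelow.of_le_left {x a b : S} (hx : x ≤ a) (h : WayBelow a b) : WayBelow x b :=
  fun c hc s hs hbs => (h c hc s hs hbs).imp fun _ hn => hx.trans hn

theorem WayBelow.of_le_right {a b y : S} (h : WayBelow a b) (hy : b ≤ y) : WayBelow a y :=
  fun c hc s hs hys => h c hc s hs (hy.trans hys)

end WayBelowBasic

theorem wayBelow_zero {S : Type*} [AddCommMonoid S] [PartialOrder S] [CuSemigroup S] {a : S} :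
    WayBelow (0 : S) a :=
  fun _ _ _ _ _ => ⟨0, CuSemigroup.zero_le' _⟩

/-- Interpolation: if `a' ≪ a` then there is `x` with `a' ≪ x ≪ a`. -/
theorem exists_interpolate {S : Type*} [AddCommMonoid S] [PartialOrder S] [CuSemigroup S]
    {a' a : S} (h : WayBelow a' a) : ∃ x : S, WayBelow a' x ∧ WayBelow x a := by
  obtain ⟨c, hc, hlub⟩ := CuSemigroup.O2 a
  have hmono : Monotone c := monotone_nat_of_le_succ fun n => (hc n).le
  obtain ⟨n, hn⟩ := h c hmono a hlub le_rfl
  exact ⟨c (n + 1), WayBelow.of_le_left hn (hc n),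
    WayBelow.of_le_right (hc (n + 1)) (hlub.1 (Set.mem_range_self (n + 2)))⟩

/-! ### Generalized Cu-morphisms -/

/-- A generalized `Cu`-morphism: additive, monotone, zero preserving map which preserves
suprema of increasing sequences. -/
structure GenCuMor (S : Type*) (T : Type*) [AddCommMonoid S] [PartialOrder S]
    [AddCommMonoid T] [PartialOrder T] where
  toFun : S → T
  map_zero' : toFun 0 = 0
  map_add' : ∀ a b : S, toFun (a + b) = toFun a + toFun b
  mono' : Monotone toFun
  map_sup' : ∀ (c : ℕ → S) (s : S), Monotone c → IsLUB (Set.range c) s →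
    IsLUB (Set.range (fun n => toFun (c n))) (toFun s)

namespace GenCuMor

variable {S T P : Type*} [AddCommMonoid S] [PartialOrder S] [AddCommMonoid T] [PartialOrder T]
  [AddCommMonoid P] [PartialOrder P]

theorem ext' {f g : GenCuMor S T} (h : f.toFun = g.toFun) : f = g := by
  cases f; cases g; cases h; rfl

instance : PartialOrder (GenCuMor S T) where
  le f g := ∀ a : S, f.toFun a ≤ g.toFun a
  le_refl f a := le_rfl
  le_trans f g h h1 h2 a := (h1 a).trans (h2 a)
  le_antisymm f g h1 h2 := ext' (funext fun a => le_antisymm (h1 a) (h2 a))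

theorem le_def {f g : GenCuMor S T} : f ≤ g ↔ ∀ a : S, f.toFun a ≤ g.toFun a := Iff.rfl

instance : Zero (GenCuMor S T) where
  zero :=
    { toFun := fun _ => 0
      map_zero' := rfl
      map_add' := fun _ _ => (add_zero 0).symm
      mono' := monotone_const
      map_sup' := fun _ _ _ _ => by
        rw [Set.range_const]; exact isLUB_singleton }

@[simp] theorem zero_toFun (a : S) : (0 : GenCuMor S T).toFun a = 0 := rfl

instance [CuSemigroup T] : Add (GenCuMor S T) where
  add f g :=
    { toFun := fun a => f.toFun a + g.toFun a
      map_zero' := by show f.toFun 0 + g.toFun 0 = 0; rw [f.map_zero', g.map_zero', add_zero]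
      map_add' := by
        intro a b
        show f.toFun (a + b) + g.toFun (a + b) = _
        rw [f.map_add', g.map_add', add_add_add_comm]
      mono' := fun a b h => CuSemigroup.add_le_add' _ _ _ _ (f.mono' h) (g.mono' h)
      map_sup' := fun c s hc hs =>
        CuSemigroup.O4 (fun n => f.toFun (c n)) (fun n => g.toFun (c n)) _ _
          (fun _ _ h => f.mono' (hc h)) (fun _ _ h => g.mono' (hc h))
          (f.map_sup' c s hc hs) (g.map_sup' c s hc hs) }

@[simp] theorem add_toFun [CuSemigroup T] (f g : GenCuMor S T) (a : S) :
    (f + g).toFun a = f.toFun a + g.toFun a := rfl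

instance [CuSemigroup T] : AddCommMonoid (GenCuMor S T) where
  add := (· + ·)
  zero := 0
  add_assoc f g h := ext' (funext fun a => add_assoc (f.toFun a) (g.toFun a) (h.toFun a))
  zero_add f := ext' (funext fun a => zero_add (f.toFun a))
  add_zero f := ext' (funext fun a => add_zero (f.toFun a))
  add_comm f g := ext' (funext fun a => add_comm (f.toFun a) (g.toFun a))
  nsmul := nsmulRec
  nsmul_zero := fun _ => rfl
  nsmul_succ := fun _ _ => rfl

/-- Composition of generalized Cu-morphisms. -/
def comp (g : GenCuMor T P) (f : GenCuMor S T) : GenCuMor S P where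
  toFun := fun a => g.toFun (f.toFun a)
  map_zero' := by show g.toFun (f.toFun 0) = 0; rw [f.map_zero', g.map_zero']
  map_add' := fun a b => by
    show g.toFun (f.toFun (a + b)) = g.toFun (f.toFun a) + g.toFun (f.toFun b)
    rw [f.map_add', g.map_add']
  mono' := fun a b h => g.mono' (f.mono' h)
  map_sup' := fun c s hc hs =>
    g.map_sup' (fun n => f.toFun (c n)) (f.toFun s) (fun _ _ h => f.mono' (hc h))
      (f.map_sup' c s hc hs)

@[simp] theorem comp_toFun (g : GenCuMor T P) (f : GenCuMor S T) (a : S) :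
    (g.comp f).toFun a = g.toFun (f.toFun a) := rfl

/-- The identity generalized Cu-morphism. -/
def id (S : Type*) [AddCommMonoid S] [PartialOrder S] : GenCuMor S S where
  toFun := fun a => a
  map_zero' := rfl
  map_add' := fun _ _ => rfl
  mono' := monotone_id
  map_sup' := fun _ _ _ hs => hs

end GenCuMor

/-- The auxiliary relation `f ≺ g` on generalized Cu-morphisms. -/
def Prec {S T : Type*} [AddCommMonoid S] [PartialOrder S] [AddCommMonoid T] [PartialOrder T]
    (f g : GenCuMor S T) : Prop :=
  ∀ a' a : S, WayBelow a' a → WayBelow (f.toFun a') (g.toFun a)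

namespace Prec

variable {S T P : Type*} [AddCommMonoid S] [PartialOrder S] [AddCommMonoid T] [PartialOrder T]
  [AddCommMonoid P] [PartialOrder P]

theorem trans [CuSemigroup S] {f g h : GenCuMor S T} (h1 : Prec f g) (h2 : Prec g h) :
    Prec f h := by
  intro a' a ha
  obtain ⟨x, hx1, hx2⟩ := exists_interpolate ha
  exact WayBelow.of_le_left (h1 a' x hx1).le (h2 x a hx2)

theorem add [CuSemigroup T] {f g f' g' : GenCuMor S T} (h : Prec f g) (h' : Prec f' g') :
    Prec (f + f') (g + g') :=
  fun a' a ha => CuSemigroup.O3 _ _ _ _ (h a' a ha) (h' a' a ha)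

theorem comp {f f' : GenCuMor S T} {g g' : GenCuMor T P} (hf : Prec f f') (hg : Prec g g') :
    Prec (g.comp f) (g'.comp f') :=
  fun a' a ha => hg _ _ (hf a' a ha)

end Prec

/-! ### Paths and the bivariant Cu-semigroup -/

/-- The index set `ℚ ∩ (0,1)` for paths. -/
abbrev IQ : Type := {q : ℚ // 0 < q ∧ q < 1}

theorem IQ.exists_gt (l : IQ) : ∃ m : IQ, l.1 < m.1 := by
  refine ⟨⟨(l.1 + 1) / 2, ⟨by linarith [l.2.1, l.2.2], by linarith [l.2.2]⟩⟩, ?_⟩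
  simp only
  linarith [l.2.2]

theorem IQ.exists_gt₂ (l m : IQ) : ∃ r : IQ, l.1 < r.1 ∧ m.1 < r.1 := by
  have h1 : l.1 ≤ max l.1 m.1 := le_max_left _ _
  have h2 : m.1 ≤ max l.1 m.1 := le_max_right _ _
  have ht : max l.1 m.1 < 1 := max_lt l.2.2 m.2.2
  have ht0 : 0 < max l.1 m.1 := lt_of_lt_of_le l.2.1 h1
  refine ⟨⟨(max l.1 m.1 + 1) / 2, ⟨by linarith, by linarith⟩⟩, ?_, ?_⟩ <;>
    simp only <;> linarith

/-- A path of generalized Cu-morphisms: a `ℚ ∩ (0,1)`-indexed family which is increasing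
with respect to the auxiliary relation `≺`. -/
structure CuPath (S T : Type*) [AddCommMonoid S] [PartialOrder S]
    [AddCommMonoid T] [PartialOrder T] where
  f : IQ → GenCuMor S T
  prec : ∀ l m : IQ, l.1 < m.1 → Prec (f l) (f m)

namespace CuPath

variable {S T P : Type*} [AddCommMonoid S] [PartialOrder S] [AddCommMonoid T] [PartialOrder T]
  [AddCommMonoid P] [PartialOrder P]

theorem ext' {p q : CuPath S T} (h : p.f = q.f) : p = q := by
  cases p; cases q; cases h; rfl

end CuPath

/-- The preorder `f ≾ g` on paths. -/
def PathLE {S T : Type*} [AddCommMonoid S] [PartialOrder S] [AddCommMonoid T] [PartialOrder T]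
    (p q : CuPath S T) : Prop :=
  ∀ l : IQ, ∃ m : IQ, Prec (p.f l) (q.f m)

/-- The equivalence relation on paths: `p ∼ q` iff `p ≾ q` and `q ≾ p`. -/
def PathEquiv {S T : Type*} [AddCommMonoid S] [PartialOrder S] [AddCommMonoid T] [PartialOrder T]
    (p q : CuPath S T) : Prop :=
  PathLE p q ∧ PathLE q p

namespace PathLE

variable {S T : Type*} [AddCommMonoid S] [PartialOrder S] [AddCommMonoid T] [PartialOrder T]

theorem refl (p : CuPath S T) : PathLE p p := fun l =>
  let ⟨m, hm⟩ := IQ.exists_gt l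
  ⟨m, p.prec l m hm⟩

theorem trans [CuSemigroup S] {p q r : CuPath S T} (h1 : PathLE p q) (h2 : PathLE q r) :
    PathLE p r := fun l =>
  let ⟨m, hm⟩ := h1 l
  let ⟨n, hn⟩ := h2 m
  ⟨n, hm.trans hn⟩

end PathLE

instance CuPath.setoid (S T : Type*) [AddCommMonoid S] [PartialOrder S] [AddCommMonoid T]
    [PartialOrder T] [CuSemigroup S] : Setoid (CuPath S T) where
  r := PathEquiv
  iseqv :=
    { refl := fun p => ⟨PathLE.refl p, PathLE.refl p⟩
      symm := fun h => ⟨h.2, h.1⟩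
      trans := fun h1 h2 => ⟨h1.1.trans h2.1, h2.2.trans h1.2⟩ }

/-- The bivariant Cu-semigroup `⟦S,T⟧`: equivalence classes of paths. -/
def BivCu (S T : Type*) [AddCommMonoid S] [PartialOrder S] [AddCommMonoid T] [PartialOrder T]
    [CuSemigroup S] : Type _ :=
  Quotient (CuPath.setoid S T)

namespace BivCu

variable {S T P Q : Type*} [AddCommMonoid S] [PartialOrder S] [AddCommMonoid T] [PartialOrder T]
  [AddCommMonoid P] [PartialOrder P] [AddCommMonoid Q] [PartialOrder Q]

/-- Class of a path in the bivariant Cu-semigroup. -/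
def mk [CuSemigroup S] (p : CuPath S T) : BivCu S T := Quotient.mk (CuPath.setoid S T) p

instance [CuSemigroup S] : PartialOrder (BivCu S T) where
  le := Quotient.lift₂ PathLE (by
    intro p q p' q' hp hq
    exact propext ⟨fun h => (hp.2.trans h).trans hq.1, fun h => (hp.1.trans h).trans hq.2⟩)
  le_refl := by
    rintro ⟨p⟩
    exact PathLE.refl p
  le_trans := by
    rintro ⟨p⟩ ⟨q⟩ ⟨r⟩ h1 h2
    exact PathLE.trans h1 h2
  le_antisymm := by
    rintro ⟨p⟩ ⟨q⟩ h1 h2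
    exact Quotient.sound ⟨h1, h2⟩

theorem mk_le_mk [CuSemigroup S] {p q : CuPath S T} : mk p ≤ mk q ↔ PathLE p q := Iff.rfl

end BivCu

/-- Pointwise addition of paths. -/
def CuPath.add {S T : Type*} [AddCommMonoid S] [PartialOrder S] [AddCommMonoid T]
    [PartialOrder T] [CuSemigroup T] (p q : CuPath S T) : CuPath S T where
  f l := p.f l + q.f l
  prec l m h := (p.prec l m h).add (q.prec l m h)

/-- The zero path. -/
def CuPath.zero (S T : Type*) [AddCommMonoid S] [PartialOrder S] [AddCommMonoid T]
    [PartialOrder T] [CuSemigroup T] : CuPath S T where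
  f _ := 0
  prec _ _ _ := fun _ _ _ => wayBelow_zero

theorem PathLE.add {S T : Type*} [AddCommMonoid S] [PartialOrder S] [AddCommMonoid T]
    [PartialOrder T] [CuSemigroup S] [CuSemigroup T] {p p' q q' : CuPath S T}
    (hp : PathLE p p') (hq : PathLE q q') : PathLE (p.add q) (p'.add q') := by
  intro l
  obtain ⟨m1, h1⟩ := hp l
  obtain ⟨m2, h2⟩ := hq l
  obtain ⟨r, hr1, hr2⟩ := IQ.exists_gt₂ m1 m2
  exact ⟨r, (h1.trans (p'.prec m1 r hr1)).add (h2.trans (q'.prec m2 r hr2))⟩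

theorem PathEquiv.add {S T : Type*} [AddCommMonoid S] [PartialOrder S] [AddCommMonoid T]
    [PartialOrder T] [CuSemigroup S] [CuSemigroup T] {p p' q q' : CuPath S T}
    (hp : PathEquiv p p') (hq : PathEquiv q q') : PathEquiv (p.add q) (p'.add q') :=
  ⟨PathLE.add hp.1 hq.1, PathLE.add hp.2 hq.2⟩

namespace BivCu

variable {S T P : Type*} [AddCommMonoid S] [PartialOrder S] [AddCommMonoid T] [PartialOrder T]
  [AddCommMonoid P] [PartialOrder P]

instance [CuSemigroup S] [CuSemigroup T] : Add (BivCu S T) where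
  add := Quotient.map₂ CuPath.add (fun _ _ hp _ _ hq => PathEquiv.add hp hq)

instance [CuSemigroup S] [CuSemigroup T] : Zero (BivCu S T) where
  zero := mk (CuPath.zero S T)

instance [CuSemigroup S] [CuSemigroup T] : AddCommMonoid (BivCu S T) where
  add := (· + ·)
  zero := 0
  add_assoc := by
    rintro ⟨p⟩ ⟨q⟩ ⟨r⟩
    exact congrArg (Quotient.mk _) (CuPath.ext' (funext fun l => add_assoc _ _ _))
  zero_add := by
    rintro ⟨p⟩
    exact congrArg (Quotient.mk _) (CuPath.ext' (funext fun l => zero_add _))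
  add_zero := by
    rintro ⟨p⟩
    exact congrArg (Quotient.mk _) (CuPath.ext' (funext fun l => add_zero _))
  add_comm := by
    rintro ⟨p⟩ ⟨q⟩
    exact congrArg (Quotient.mk _) (CuPath.ext' (funext fun l => add_comm _ _))
  nsmul := nsmulRec
  nsmul_zero := fun _ => rfl
  nsmul_succ := fun _ _ => rfl

theorem mk_add_mk [CuSemigroup S] [CuSemigroup T] (p q : CuPath S T) :
    mk p + mk q = mk (p.add q) := rfl

end BivCu

/-- Composition of paths. -/
def CuPath.comp {S T P : Type*} [AddCommMonoid S] [PartialOrder S] [AddCommMonoid T]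
    [PartialOrder T] [AddCommMonoid P] [PartialOrder P]
    (q : CuPath T P) (p : CuPath S T) : CuPath S P where
  f l := (q.f l).comp (p.f l)
  prec l m h := Prec.comp (p.prec l m h) (q.prec l m h)

theorem PathLE.comp {S T P : Type*} [AddCommMonoid S] [PartialOrder S] [AddCommMonoid T]
    [PartialOrder T] [AddCommMonoid P] [PartialOrder P] [CuSemigroup S] [CuSemigroup T]
    {q q' : CuPath T P} {p p' : CuPath S T} (hq : PathLE q q') (hp : PathLE p p') :
    PathLE (q.comp p) (q'.comp p') := by
  intro l
  obtain ⟨m1, h1⟩ := hp l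
  obtain ⟨m2, h2⟩ := hq l
  obtain ⟨r, hr1, hr2⟩ := IQ.exists_gt₂ m1 m2
  exact ⟨r, Prec.comp (h1.trans (p'.prec m1 r hr1)) (h2.trans (q'.prec m2 r hr2))⟩

theorem PathEquiv.comp {S T P : Type*} [AddCommMonoid S] [PartialOrder S] [AddCommMonoid T]
    [PartialOrder T] [AddCommMonoid P] [PartialOrder P] [CuSemigroup S] [CuSemigroup T]
    {q q' : CuPath T P} {p p' : CuPath S T} (hq : PathEquiv q q') (hp : PathEquiv p p') :
    PathEquiv (q.comp p) (q'.comp p') :=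
  ⟨PathLE.comp hq.1 hp.1, PathLE.comp hq.2 hp.2⟩

/-- The composition product on bivariant Cu-semigroups. -/
def BivCu.comp {S T P : Type*} [AddCommMonoid S] [PartialOrder S] [AddCommMonoid T]
    [PartialOrder T] [AddCommMonoid P] [PartialOrder P] [CuSemigroup S] [CuSemigroup T]
    (y : BivCu T P) (x : BivCu S T) : BivCu S P :=
  Quotient.map₂ CuPath.comp (fun _ _ hq _ _ hp => PathEquiv.comp hq hp) y x

theorem BivCu.comp_mk_mk {S T P : Type*} [AddCommMonoid S] [PartialOrder S] [AddCommMonoid T]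
    [PartialOrder T] [AddCommMonoid P] [PartialOrder P] [CuSemigroup S] [CuSemigroup T]
    (q : CuPath T P) (p : CuPath S T) :
    BivCu.comp (BivCu.mk q) (BivCu.mk p) = BivCu.mk (q.comp p) := rfl

/-- The constant path at the identity morphism. -/
def CuPath.id (S : Type*) [AddCommMonoid S] [PartialOrder S] : CuPath S S where
  f _ := GenCuMor.id S
  prec _ _ _ := fun _ _ ha => ha

/-- The class of the constant path at the identity: the unit of `⟦S,S⟧`. -/
def BivCu.id (S : Type*) [AddCommMonoid S] [PartialOrder S] [CuSemigroup S] : BivCu S S :=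
  BivCu.mk (CuPath.id S)

/-! ### Ideals, morphism predicates, bimorphisms, softness, elementary paths -/

/-- An ideal of a Cu-semigroup: a downward hereditary submonoid closed under
suprema of increasing sequences. -/
def IsCuIdeal {S : Type*} [AddCommMonoid S] [PartialOrder S] (J : Set S) : Prop :=
  (0 : S) ∈ J ∧ (∀ a b : S, a ∈ J → b ∈ J → a + b ∈ J) ∧
  (∀ a b : S, b ≤ a → a ∈ J → b ∈ J) ∧
  (∀ c : ℕ → S, Monotone c → (∀ n, c n ∈ J) → ∀ s : S, IsLUB (Set.range c) s → s ∈ J)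

/-- Predicate: `f` is (the function of) a generalized Cu-morphism. -/
def IsGenCuMorFun {S T : Type*} [AddCommMonoid S] [PartialOrder S] [AddCommMonoid T]
    [PartialOrder T] (f : S → T) : Prop :=
  f 0 = 0 ∧ (∀ a b : S, f (a + b) = f a + f b) ∧ Monotone f ∧
  ∀ (c : ℕ → S) (s : S), Monotone c → IsLUB (Set.range c) s →
    IsLUB (Set.range (fun n => f (c n))) (f s)

/-- Predicate: `f` is a Cu-morphism (generalized Cu-morphism preserving way-below). -/
def IsCuMorFun {S T : Type*} [AddCommMonoid S] [PartialOrder S] [AddCommMonoid T]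
    [PartialOrder T] (f : S → T) : Prop :=
  IsGenCuMorFun f ∧ ∀ a b : S, WayBelow a b → WayBelow (f a) (f b)

/-- Predicate: `φ` is a Cu-bimorphism. -/
def IsCuBimor {A B C : Type*} [AddCommMonoid A] [PartialOrder A] [AddCommMonoid B]
    [PartialOrder B] [AddCommMonoid C] [PartialOrder C] (φ : A → B → C) : Prop :=
  (∀ b : B, φ 0 b = 0) ∧ (∀ a : A, φ a 0 = 0) ∧
  (∀ (a a' : A) (b : B), φ (a + a') b = φ a b + φ a' b) ∧
  (∀ (a : A) (b b' : B), φ a (b + b') = φ a b + φ a b') ∧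
  (∀ (a a' : A) (b : B), a ≤ a' → φ a b ≤ φ a' b) ∧
  (∀ (a : A) (b b' : B), b ≤ b' → φ a b ≤ φ a b') ∧
  (∀ (c : ℕ → A) (d : ℕ → B) (s : A) (t : B), Monotone c → Monotone d →
    IsLUB (Set.range c) s → IsLUB (Set.range d) t →
    IsLUB (Set.range (fun n => φ (c n) (d n))) (φ s t)) ∧
  (∀ (a' a : A) (b' b : B), WayBelow a' a → WayBelow b' b → WayBelow (φ a' b') (φ a b))

/-- A path in `(R, ≪)`: a `ℚ ∩ (0,1)`-indexed family, increasing with respect to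
the way-below relation. -/
structure ElemPath (R : Type*) [Preorder R] where
  f : IQ → R
  prec : ∀ l m : IQ, l.1 < m.1 → WayBelow (f l) (f m)

/-- A soft element of a Cu-semigroup. -/
def IsSoft {S : Type*} [AddCommMonoid S] [PartialOrder S] (a : S) : Prop :=
  ∀ a' : S, WayBelow a' a → ∃ k : ℕ, (k + 1) • a' ≤ k • a

/-! ### Suprema and the way-below relation in `⟦S,T⟧` -/

/-- Multiplication on `ℚ ∩ (0,1)`. -/
def IQ.mul (r l : IQ) : IQ :=
  ⟨r.1 * l.1, mul_pos r.2.1 l.2.1, mul_lt_one_of_nonneg_of_lt_one_left r.2.1.le r.2.2 l.2.2.le⟩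

/-- The point `a + t * (1 - a) / 2` between `a` and the midpoint of `a` and `1`. -/
def IQ.towardOne (a : IQ) (t : ℚ) (h0 : 0 ≤ t) (h1 : t ≤ 1) : IQ :=
  ⟨a.1 + t * ((1 - a.1) / 2), by
    have := mul_nonneg h0 (by linarith [a.2.2] : 0 ≤ (1 - a.1) / 2)
    linarith [a.2.1], by
    have := mul_le_mul_of_nonneg_right h1 (by linarith [a.2.2] : 0 ≤ (1 - a.1) / 2)
    linarith [a.2.2]⟩

theorem IQ.towardOne_lt_towardOne (a : IQ) {t u : ℚ} (h0 : 0 ≤ t) (h1 : t ≤ 1) (h0' : 0 ≤ u)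
    (h1' : u ≤ 1) (h : t < u) : (a.towardOne t h0 h1).1 < (a.towardOne u h0' h1').1 := by
  have := mul_lt_mul_of_pos_right h (by linarith [a.2.2] : 0 < (1 - a.1) / 2)
  simpa [towardOne] using this

theorem IQ.towardOne_zero (a : IQ) : a.towardOne 0 le_rfl zero_le_one = a :=
  Subtype.ext (by simp [towardOne])

section Diagonal

variable {S T : Type*} [AddCommMonoid S] [PartialOrder S] [AddCommMonoid T] [PartialOrder T]
  [CuSemigroup S]

/-- Concatenation of segments of paths: if `p n` starting at `a n` and running to the midpoint of
`a n` and `1` is followed, with respect to `≺`, by the starting point of the next segment, then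
there is a path running through all these segments. -/
theorem CuPath.exists_concat (p : ℕ → CuPath S T) (a : ℕ → IQ)
    (h : ∀ n, Prec ((p n).f ((a n).towardOne 1 zero_le_one le_rfl)) ((p (n + 1)).f (a (n + 1)))) :
    ∃ q : CuPath S T, (∀ n, ∃ l, Prec ((p n).f (a n)) (q.f l)) ∧
      ∀ l, ∃ n m, Prec (q.f l) ((p n).f m) := by
  have hstart : ∀ n, Prec ((p n).f (a n)) ((p n).f ((a n).towardOne 1 zero_le_one le_rfl)) := by
    intro n
    have := (a n).towardOne_lt_towardOne le_rfl zero_le_one zero_le_one le_rfl zero_lt_one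
    rw [IQ.towardOne_zero] at this
    exact (p n).prec _ _ this
  have hchain : ∀ n k, Prec ((p n).f ((a n).towardOne 1 zero_le_one le_rfl))
      ((p (n + 1 + k)).f (a (n + 1 + k))) := by
    intro n k
    induction k with
    | zero => exact h n
    | succ k ih => exact ih.trans ((hstart _).trans (h _))
  let u : IQ → ℚ := fun l => l.1 / (1 - l.1)
  have hu0 : ∀ l, 0 ≤ u l := fun l => div_nonneg l.2.1.le (by linarith [l.2.2])
  have hu : ∀ l m : IQ, l.1 < m.1 → u l < u m := by
    intro l m hlm
    rw [div_lt_div_iff₀ (by linarith [l.2.2]) (by linarith [m.2.2])]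
    nlinarith
  have hf0 : ∀ l, 0 ≤ u l - ⌊u l⌋₊ := fun l => sub_nonneg.2 (Nat.floor_le (hu0 l))
  have hf1 : ∀ l, u l - ⌊u l⌋₊ < 1 := fun l => by linarith [Nat.lt_floor_add_one (u l)]
  let s : IQ → IQ := fun l => (a ⌊u l⌋₊).towardOne (u l - ⌊u l⌋₊) (hf0 l) (hf1 l).le
  have hend : ∀ l, Prec ((p ⌊u l⌋₊).f (s l))
      ((p ⌊u l⌋₊).f ((a ⌊u l⌋₊).towardOne 1 zero_le_one le_rfl)) := fun l =>
    (p _).prec _ _ (IQ.towardOne_lt_towardOne _ _ _ _ _ (hf1 l))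
  have hbegin : ∀ l g, Prec g ((p ⌊u l⌋₊).f (a ⌊u l⌋₊)) → Prec g ((p ⌊u l⌋₊).f (s l)) := by
    intro l g hg
    rcases (hf0 l).eq_or_lt with h0 | h0
    · have : s l = a ⌊u l⌋₊ := Subtype.ext (by simp [s, IQ.towardOne, ← h0])
      rwa [this]
    · have := (a ⌊u l⌋₊).towardOne_lt_towardOne le_rfl zero_le_one (hf0 l) (hf1 l).le h0
      rw [IQ.towardOne_zero] at this
      exact hg.trans ((p _).prec _ _ this)
  refine ⟨⟨fun l => (p ⌊u l⌋₊).f (s l), ?_⟩, ?_, fun l => ⟨_, _, hend l⟩⟩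
  · intro l m hlm
    rcases (Nat.floor_mono (hu l m hlm).le).eq_or_lt with he | hlt
    · have hs : (s l).1 < (s m).1 := by
        have hpos : 0 < (1 - (a ⌊u m⌋₊).1) / 2 := by linarith [(a ⌊u m⌋₊).2.2]
        have := mul_lt_mul_of_pos_right (hu l m hlm) hpos
        simp only [s, IQ.towardOne, he]
        linarith
      have := (p ⌊u m⌋₊).prec _ _ hs
      rwa [← he] at this ⊢
    · obtain ⟨k, hk⟩ := Nat.exists_eq_add_of_le (Nat.succ_le_of_lt hlt)
      refine (hend l).trans (hbegin m _ ?_)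
      have := hchain ⌊u l⌋₊ k
      rwa [← Nat.succ_eq_add_one, ← hk] at this
  · intro n
    have hn : (0 : ℚ) ≤ n := n.cast_nonneg
    let l : IQ := ⟨(n + 1) / (n + 2), by positivity, by
      rw [div_lt_one (by positivity)]; linarith⟩
    have hl : u l = (n + 1 : ℕ) := by
      simp only [u, l]; push_cast; field_simp; ring
    have hfl : ⌊u l⌋₊ = n + 1 := by rw [hl, Nat.floor_natCast]
    refine ⟨l, hbegin l _ ?_⟩
    rw [hfl]
    exact (hstart n).trans (h n)

/-- An increasing sequence of paths has an upper bound all of whose members are dominated by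
members of the sequence. -/
theorem CuPath.exists_diagonal (p : ℕ → CuPath S T) (hp : ∀ m n, m ≤ n → PathLE (p m) (p n)) :
    ∃ q : CuPath S T, (∀ n, PathLE (p n) q) ∧ ∀ l, ∃ n m, Prec (q.f l) ((p n).f m) := by
  let e : ℕ × IQ → IQ := fun x => x.2.towardOne 1 zero_le_one le_rfl
  let r : ℕ × IQ → ℕ × IQ → Prop := fun x y => Prec ((p x.1).f (e x)) ((p y.1).f y.2)
  have hdir : Directed r (fun x : ℕ × IQ => x) := by
    intro x y
    obtain ⟨l, hl⟩ := hp x.1 (max x.1 y.1) (le_max_left _ _) (e x)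
    obtain ⟨m, hm⟩ := hp y.1 (max x.1 y.1) (le_max_right _ _) (e y)
    obtain ⟨k, hlk, hmk⟩ := IQ.exists_gt₂ l m
    exact ⟨(max x.1 y.1, k), hl.trans ((p _).prec _ _ hlk), hm.trans ((p _).prec _ _ hmk)⟩
  have : Inhabited (ℕ × IQ) := ⟨(0, ⟨1 / 2, by norm_num⟩)⟩
  obtain ⟨q, hq, hq'⟩ := CuPath.exists_concat (fun n => p (hdir.sequence _ n).1)
    (fun n => (hdir.sequence _ n).2) (fun n => hdir.sequence_mono_nat n)
  refine ⟨q, fun n l => ?_, fun l => ?_⟩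
  · obtain ⟨m, hm⟩ := hq (Encodable.encode (n, l) + 1)
    have hlt := l.towardOne_lt_towardOne le_rfl zero_le_one zero_le_one le_rfl zero_lt_one
    rw [IQ.towardOne_zero] at hlt
    have hr : r (n, l) _ := hdir.rel_sequence (n, l)
    exact ⟨m, ((p n).prec _ _ hlt).trans (hr.trans hm)⟩
  · obtain ⟨n, m, h⟩ := hq' l
    exact ⟨_, m, h⟩

end Diagonal

section Cut

variable {S T : Type*} [AddCommMonoid S] [PartialOrder S] [AddCommMonoid T] [PartialOrder T]

/-- The path `p` cut down at `r`, that is, restricted to `(0, r)` and rescaled. -/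
def CuPath.cut (p : CuPath S T) (r : IQ) : CuPath S T where
  f l := p.f (r.mul l)
  prec _ _ h := p.prec _ _ (mul_lt_mul_of_pos_left h r.2.1)

theorem CuPath.cut_mono (p : CuPath S T) {r s : IQ} (h : r.1 ≤ s.1) :
    PathLE (p.cut r) (p.cut s) := by
  intro l
  obtain ⟨m, hm⟩ := IQ.exists_gt l
  refine ⟨m, p.prec _ _ ?_⟩
  exact (mul_le_mul_of_nonneg_right h l.2.1.le).trans_lt (mul_lt_mul_of_pos_left hm s.2.1)

theorem CuPath.exists_cut_eq (p : CuPath S T) {l r : IQ} (h : l.1 < r.1) :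
    ∃ m, (p.cut r).f m = p.f l := by
  refine ⟨⟨l.1 / r.1, div_pos l.2.1 r.2.1, (div_lt_one r.2.1).2 h⟩, ?_⟩
  exact congrArg p.f (Subtype.ext (mul_div_cancel₀ l.1 r.2.1.ne'))

theorem PathLE.of_forall_cut {p q : CuPath S T} (h : ∀ r, PathLE (p.cut r) q) : PathLE p q := by
  intro l
  obtain ⟨r, hr⟩ := IQ.exists_gt l
  obtain ⟨m, hm⟩ := p.exists_cut_eq hr
  rw [← hm]
  exact h r m

variable [CuSemigroup S]

theorem BivCu.mk_cut_wayBelow (p : CuPath S T) (r : IQ) :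
    WayBelow (BivCu.mk (p.cut r)) (BivCu.mk p) := by
  intro c hc s hs hps
  choose d hd using fun n => Quotient.exists_rep (c n)
  obtain rfl : (fun n => BivCu.mk (d n)) = c := funext hd
  obtain ⟨q, hq, hq'⟩ := CuPath.exists_diagonal d fun m n hmn => hc hmn
  have hsq : s ≤ BivCu.mk q := hs.2 (Set.forall_mem_range.2 hq)
  obtain ⟨m, hm⟩ := (hps.trans hsq : PathLE p q) r
  obtain ⟨n, k, hk⟩ := hq' m
  refine ⟨n, fun l => ⟨k, (p.prec _ _ ?_).trans (hm.trans hk)⟩⟩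
  exact mul_lt_of_lt_one_right r.2.1 l.2.2

/-- A sequence in `ℚ ∩ (0,1)` increasing to `1`. -/
def IQ.toOne (n : ℕ) : IQ :=
  ⟨1 - 1 / (n + 2), by
    rw [sub_pos, div_lt_one (by positivity)]
    linarith [(n.cast_nonneg : (0 : ℚ) ≤ n)], by
    rw [sub_lt_self_iff]
    positivity⟩

theorem IQ.toOne_mono {m n : ℕ} (h : m ≤ n) : (IQ.toOne m).1 ≤ (IQ.toOne n).1 := by
  have : (m : ℚ) ≤ n := by exact_mod_cast h
  simp only [toOne]
  gcongr

theorem IQ.exists_le_toOne (r : IQ) : ∃ n, r.1 ≤ (IQ.toOne n).1 := by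
  obtain ⟨n, hn⟩ := exists_nat_one_div_lt (sub_pos.2 r.2.2)
  have : (1 : ℚ) / (n + 2) ≤ 1 / (n + 1) := by gcongr; norm_num
  exact ⟨n, by simp only [toOne]; linarith⟩

theorem BivCu.exists_le_mk_cut {x : BivCu S T} {p : CuPath S T} (h : WayBelow x (BivCu.mk p)) :
    ∃ r, x ≤ BivCu.mk (p.cut r) := by
  obtain ⟨n, hn⟩ := h (fun n => BivCu.mk (p.cut (IQ.toOne n)))
    (fun m n hmn => p.cut_mono (IQ.toOne_mono hmn)) (BivCu.mk p)
    ⟨Set.forall_mem_range.2 fun n => (BivCu.mk_cut_wayBelow p _).le, by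
      rintro ⟨q⟩ hq
      refine PathLE.of_forall_cut (p := p) fun r => ?_
      obtain ⟨n, hn⟩ := r.exists_le_toOne
      exact (p.cut_mono hn).trans (hq (Set.mem_range_self n))⟩ le_rfl
  exact ⟨_, hn⟩

end Cut

namespace BivCu

variable {S T P : Type*} [AddCommMonoid S] [PartialOrder S] [AddCommMonoid T] [PartialOrder T]
  [AddCommMonoid P] [PartialOrder P] [CuSemigroup S] [CuSemigroup T]

theorem comp_mono {y y' : BivCu T P} {x x' : BivCu S T} (hy : y ≤ y') (hx : x ≤ x') :
    comp y x ≤ comp y' x' := by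
  obtain ⟨q⟩ := y
  obtain ⟨q'⟩ := y'
  obtain ⟨p⟩ := x
  obtain ⟨p'⟩ := x'
  exact PathLE.comp hy hx

theorem isLUB_comp {c : ℕ → BivCu T P} {d : ℕ → BivCu S T} {s : BivCu T P} {t : BivCu S T}
    (hc : Monotone c) (hd : Monotone d) (hs : IsLUB (Set.range c) s)
    (ht : IsLUB (Set.range d) t) : IsLUB (Set.range fun n => comp (c n) (d n)) (comp s t) := by
  refine ⟨Set.forall_mem_range.2 fun n => comp_mono (hs.1 ⟨n, rfl⟩) (ht.1 ⟨n, rfl⟩),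
    fun u hu => ?_⟩
  obtain ⟨q⟩ := s
  obtain ⟨p⟩ := t
  obtain ⟨v⟩ := u
  refine PathLE.of_forall_cut (p := q.comp p) fun r => ?_
  obtain ⟨m, hm⟩ := mk_cut_wayBelow q r c hc _ hs le_rfl
  obtain ⟨n, hn⟩ := mk_cut_wayBelow p r d hd _ ht le_rfl
  exact (comp_mono (hm.trans (hc (le_max_left m n))) (hn.trans (hd (le_max_right m n)))).trans
    (hu ⟨max m n, rfl⟩)

theorem comp_wayBelow_comp {y' y : BivCu T P} {x' x : BivCu S T} (hy : WayBelow y' y)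
    (hx : WayBelow x' x) : WayBelow (comp y' x') (comp y x) := by
  obtain ⟨q⟩ := y
  obtain ⟨p⟩ := x
  obtain ⟨r, hr⟩ := exists_le_mk_cut (p := q) hy
  obtain ⟨r', hr'⟩ := exists_le_mk_cut (p := p) hx
  obtain ⟨s, hs, hs'⟩ := IQ.exists_gt₂ r r'
  refine WayBelow.of_le_left ?_ (mk_cut_wayBelow (q.comp p) s)
  exact comp_mono (hr.trans (mk_le_mk.2 (q.cut_mono hs.le))) (hr'.trans (mk_le_mk.2 (p.cut_mono hs'.le)))

end BivCu

/-- Composition of paths is a path, it respects the equivalence of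
paths, and the induced composition product `⟦T,P⟧ × ⟦S,T⟧ → ⟦S,P⟧` is a well-defined
Cu-bimorphism. -/
theorem composition_product_wellDefined_CuBimorphism
    (S T P : Type*) [AddCommMonoid S] [PartialOrder S] [AddCommMonoid T] [PartialOrder T]
    [AddCommMonoid P] [PartialOrder P] [CuSemigroup S] [CuSemigroup T] [CuSemigroup P] :
    (∀ (p : CuPath S T) (q : CuPath T P) (l m : IQ), l.1 < m.1 →
      Prec ((q.f l).comp (p.f l)) ((q.f m).comp (p.f m))) ∧
    (∀ (p p' : CuPath S T) (q q' : CuPath T P), PathEquiv p p' → PathEquiv q q' →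
      PathEquiv (q.comp p) (q'.comp p')) ∧
    (∀ (p : CuPath S T) (q : CuPath T P),
      BivCu.comp (BivCu.mk q) (BivCu.mk p) = BivCu.mk (q.comp p)) ∧
    IsCuBimor (fun (y : BivCu T P) (x : BivCu S T) => BivCu.comp y x) := by
  refine ⟨fun p q => (q.comp p).prec, fun _ _ _ _ hp hq => hq.comp hp,
    fun p q => BivCu.comp_mk_mk q p, ?_, ?_, ?_, ?_,
    fun _ _ _ h => BivCu.comp_mono h le_rfl, fun _ _ _ h => BivCu.comp_mono le_rfl h,
    fun _ _ _ _ => BivCu.isLUB_comp, fun _ _ _ _ => BivCu.comp_wayBelow_comp⟩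
  · rintro ⟨p⟩
    rfl
  · rintro ⟨q⟩
    exact congrArg BivCu.mk (CuPath.ext' (funext fun l =>
      GenCuMor.ext' (funext fun _ => (q.f l).map_zero')))
  · rintro ⟨q⟩ ⟨q'⟩ ⟨p⟩
    rfl
  · rintro ⟨q⟩ ⟨p⟩ ⟨p'⟩
    exact congrArg BivCu.mk (CuPath.ext' (funext fun l =>
      GenCuMor.ext' (funext fun _ => (q.f l).map_add' _ _)))
end

section
/- Let S, T, P be Cu-semigroups, let x ∈ ⟦S,T⟧ and y ∈ ⟦T,P⟧. Then the endpoint map is multiplicative with respect to the composition product: σ_{S,P}(y∘x) = σ_{T,P}(y) ∘ σ_{S,T}(x) as generalized Cu-morphisms from S to P. In particular, (y∘x)(a) = y(x(a)) for all a ∈ S, where w(a) denotes σ(w)(a). -/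
theorem Prec.le {S T : Type*} [AddCommMonoid S] [PartialOrder S] [AddCommMonoid T]
    [PartialOrder T] [CuSemigroup S] {f g : GenCuMor S T} (h : Prec f g) : f ≤ g := by
  intro a
  obtain ⟨c, hc, hlub⟩ := CuSemigroup.O2 a
  have hmono : Monotone c := monotone_nat_of_le_succ fun n => (hc n).le
  refine (f.map_sup' c a hmono hlub).2 ?_
  rintro _ ⟨n, rfl⟩
  exact (h _ _ (hc n)).le.trans (g.mono' (hlub.1 ⟨n + 1, rfl⟩))

theorem CuPath.monotone {S T : Type*} [AddCommMonoid S] [PartialOrder S] [AddCommMonoid T]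
    [PartialOrder T] [CuSemigroup S] (p : CuPath S T) : Monotone p.f := by
  intro l m h
  rcases h.eq_or_lt with rfl | h
  · exact le_rfl
  · exact (p.prec l m h).le

theorem IQ.exists_monotone_cofinal : ∃ s : ℕ → IQ, Monotone s ∧ ∀ l : IQ, ∃ n, l ≤ s n := by
  have hpos (n : ℕ) : (0 : ℚ) < n + 2 := by positivity
  refine ⟨fun n => ⟨1 - 1 / ((n : ℚ) + 2), ?_, ?_⟩, ?_, ?_⟩
  · rw [sub_pos, div_lt_one (hpos n)]
    linarith [(Nat.cast_nonneg n : (0 : ℚ) ≤ n)]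
  · have := one_div_pos.2 (hpos n)
    linarith
  · intro m n h
    have hc : (m : ℚ) + 2 ≤ n + 2 := by exact_mod_cast Nat.add_le_add_right h 2
    exact sub_le_sub_left (one_div_le_one_div_of_le (hpos m) hc) 1
  · intro l
    obtain ⟨n, hn⟩ := exists_nat_one_div_lt (sub_pos.2 l.2.2)
    refine ⟨n, show l.1 ≤ 1 - 1 / ((n : ℚ) + 2) from ?_⟩
    have : 1 / ((n : ℚ) + 2) ≤ 1 / ((n : ℚ) + 1) :=
      one_div_le_one_div_of_le (by positivity) (by linarith)
    linarith

/-- A generalized Cu-morphism preserves the pointwise supremum of a path. -/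
theorem GenCuMor.isLUB_path {S T P : Type*} [AddCommMonoid S] [PartialOrder S]
    [AddCommMonoid T] [PartialOrder T] [AddCommMonoid P] [PartialOrder P] [CuSemigroup S]
    (g : GenCuMor T P) (p : CuPath S T) {a : S} {b : T}
    (h : IsLUB (Set.range fun l => (p.f l).toFun a) b) :
    IsLUB (Set.range fun l => g.toFun ((p.f l).toFun a)) (g.toFun b) := by
  obtain ⟨s, hs, hcof⟩ := IQ.exists_monotone_cofinal
  have hlub : IsLUB (Set.range fun n => (p.f (s n)).toFun a) b := by
    refine ⟨?_, fun u hu => h.2 ?_⟩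
    · rintro _ ⟨n, rfl⟩
      exact h.1 ⟨s n, rfl⟩
    · rintro _ ⟨l, rfl⟩
      obtain ⟨n, hn⟩ := hcof l
      exact (p.monotone hn a).trans (hu ⟨n, rfl⟩)
  refine ⟨?_, fun u hu => (g.map_sup' _ b (fun _ _ hmn => p.monotone (hs hmn) a) hlub).2 ?_⟩
  · rintro _ ⟨l, rfl⟩
    exact g.mono' (h.1 ⟨l, rfl⟩)
  · rintro _ ⟨n, rfl⟩
    exact hu ⟨s n, rfl⟩

theorem CuPath.isLUB_comp {S T P : Type*} [AddCommMonoid S] [PartialOrder S]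
    [AddCommMonoid T] [PartialOrder T] [AddCommMonoid P] [PartialOrder P] [CuSemigroup S]
    [CuSemigroup T] (q : CuPath T P) (p : CuPath S T) {a : S} {b : T} {c : P}
    (hp : IsLUB (Set.range fun l => (p.f l).toFun a) b)
    (hq : IsLUB (Set.range fun l => (q.f l).toFun b) c) :
    IsLUB (Set.range fun l => ((q.comp p).f l).toFun a) c := by
  refine ⟨?_, fun u hu => hq.2 ?_⟩
  · rintro _ ⟨l, rfl⟩
    exact ((q.f l).mono' (hp.1 ⟨l, rfl⟩)).trans (hq.1 ⟨l, rfl⟩)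
  · rintro _ ⟨l, rfl⟩
    refine ((q.f l).isLUB_path p hp).2 ?_
    rintro _ ⟨m, rfl⟩
    obtain ⟨r, hl, hm⟩ := IQ.exists_gt₂ l m
    exact ((q.f l).mono' ((p.prec m r hm).le a)).trans
      (((q.prec l r hl).le _).trans (hu ⟨r, rfl⟩))

theorem PathLE.le_of_isLUB {S T : Type*} [AddCommMonoid S] [PartialOrder S] [AddCommMonoid T]
    [PartialOrder T] [CuSemigroup S] {p q : CuPath S T} (h : PathLE p q) {a : S} {b c : T}
    (hp : IsLUB (Set.range fun l => (p.f l).toFun a) b)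
    (hq : IsLUB (Set.range fun l => (q.f l).toFun a) c) : b ≤ c := by
  refine hp.2 ?_
  rintro _ ⟨l, rfl⟩
  obtain ⟨m, hm⟩ := h l
  exact (hm.le a).trans (hq.1 ⟨m, rfl⟩)

/-- The endpoint map is multiplicative with respect to the composition
product: `σ_{S,P}(y ∘ x) = σ_{T,P}(y) ∘ σ_{S,T}(x)`; in particular `(y∘x)(a) = y(x(a))`. -/
theorem endpoint_of_composition
    (S T P : Type*) [AddCommMonoid S] [PartialOrder S] [AddCommMonoid T] [PartialOrder T]
    [AddCommMonoid P] [PartialOrder P] [CuSemigroup S] [CuSemigroup T] [CuSemigroup P]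
    (p : CuPath S T) (q : CuPath T P) (sx : S → T) (sy : T → P) (sc : S → P)
    (hsx : ∀ a : S, IsLUB (Set.range (fun l => (p.f l).toFun a)) (sx a))
    (hsy : ∀ b : T, IsLUB (Set.range (fun l => (q.f l).toFun b)) (sy b))
    (hsc : ∃ r : CuPath S P, BivCu.mk r = BivCu.comp (BivCu.mk q) (BivCu.mk p) ∧
      ∀ a : S, IsLUB (Set.range (fun l => (r.f l).toFun a)) (sc a)) :
    sc = fun a => sy (sx a) := by
  obtain ⟨r, hr, hsc⟩ := hsc
  have hequiv : PathEquiv r (q.comp p) := Quotient.exact hr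
  funext a
  have hlub := q.isLUB_comp p (hsx a) (hsy (sx a))
  exact le_antisymm (hequiv.1.le_of_isLUB (hsc a) hlub) (hequiv.2.le_of_isLUB hlub (hsc a))
end

section
/- Let S and T be Cu-semigroups, and let T' ⊆ T be a sub-Cu-semigroup, i.e. a submonoid of T that is closed under suprema of increasing sequences and such that for a', a ∈ T' one has a' ≪ a in T' if and only if a' ≪ a in T. Then the inclusion map ι: T' → T induces a well-defined order-embedding ι_*: ⟦S,T'⟧ → ⟦S,T⟧ given by ι_*([(f_λ)_λ]) = [(ι∘f_λ)_λ]; in particular, ι_*(x) ≤ ι_*(y) implies x ≤ y. -/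
section Inclusion

variable {S T : Type*} [AddCommMonoid S] [PartialOrder S] [AddCommMonoid T] [PartialOrder T]

/-- The inclusion of a submonoid closed under suprema of increasing sequences, as a generalized
Cu-morphism. -/
def GenCuMor.inclusion [CuSemigroup T] (T' : AddSubmonoid T)
    (hsup : ∀ c : ℕ → T, Monotone c → (∀ n, c n ∈ T') → ∀ s : T, IsLUB (Set.range c) s → s ∈ T') :
    GenCuMor T' T where
  toFun := Subtype.val
  map_zero' := rfl
  map_add' _ _ := rfl
  mono' _ _ h := h
  map_sup' c s hc hs := by
    obtain ⟨t, ht⟩ := CuSemigroup.O1 (fun n => (c n).1) fun _ _ h => hc h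
    have htT : t ∈ T' := hsup _ (fun _ _ h => hc h) (fun n => (c n).2) t ht
    have hst : s ≤ ⟨t, htT⟩ := hs.2 (by rintro _ ⟨n, rfl⟩; exact ht.1 ⟨n, rfl⟩)
    have hts : t ≤ s.1 := ht.2 (by rintro _ ⟨n, rfl⟩; exact hs.1 ⟨n, rfl⟩)
    rwa [le_antisymm hts hst] at ht

/-- Post-composition of a path with a generalized Cu-morphism preserving the way-below relation. -/
def CuPath.postcomp {P : Type*} [AddCommMonoid P] [PartialOrder P] (g : GenCuMor T P)
    (hg : Prec g g) (p : CuPath S T) : CuPath S P where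
  f l := g.comp (p.f l)
  prec l m h := Prec.comp (p.prec l m h) hg

theorem pathLE_iff_of_coe_eq {T' : AddSubmonoid T}
    (hwb : ∀ a b : T', WayBelow a b ↔ WayBelow a.1 b.1) {p q : CuPath S T'} {P Q : CuPath S T}
    (hP : ∀ (l : IQ) (a : S), (P.f l).toFun a = ((p.f l).toFun a).1)
    (hQ : ∀ (l : IQ) (a : S), (Q.f l).toFun a = ((q.f l).toFun a).1) :
    PathLE P Q ↔ PathLE p q := by
  simp only [PathLE, Prec, hP, hQ, hwb]

end Inclusion

/-- If `T' ⊆ T` is a sub-Cu-semigroup (a submonoid closed under suprema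
of increasing sequences on which the way-below relation agrees with that of `T`), then the
inclusion induces a well-defined order-embedding `ι_* : ⟦S,T'⟧ → ⟦S,T⟧`. -/
theorem inclusion_induces_order_embedding
    (S T : Type*) [AddCommMonoid S] [PartialOrder S] [AddCommMonoid T] [PartialOrder T]
    [CuSemigroup S] [CuSemigroup T] (T' : AddSubmonoid T)
    (hsup : ∀ c : ℕ → T, Monotone c → (∀ n, c n ∈ T') → ∀ s : T, IsLUB (Set.range c) s → s ∈ T')
    (hwb : ∀ a b : T', WayBelow a b ↔ WayBelow a.1 b.1) :
    (∀ p : CuPath S T', ∃ P : CuPath S T, ∀ (l : IQ) (a : S),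
        (P.f l).toFun a = ((p.f l).toFun a).1) ∧
    (∀ (p q : CuPath S T') (P Q : CuPath S T),
        (∀ (l : IQ) (a : S), (P.f l).toFun a = ((p.f l).toFun a).1) →
        (∀ (l : IQ) (a : S), (Q.f l).toFun a = ((q.f l).toFun a).1) →
        (PathLE P Q ↔ PathLE p q)) ∧
    (∃ F : BivCu S T' → BivCu S T,
      (∀ (p : CuPath S T') (P : CuPath S T),
        (∀ (l : IQ) (a : S), (P.f l).toFun a = ((p.f l).toFun a).1) →
        F (BivCu.mk p) = BivCu.mk P) ∧
      (∀ x y : BivCu S T', F x ≤ F y ↔ x ≤ y)) := by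
  have hι : Prec (GenCuMor.inclusion T' hsup) (GenCuMor.inclusion T' hsup) :=
    fun a b => (hwb a b).1
  have hle : ∀ (p q : CuPath S T') (P Q : CuPath S T),
      (∀ (l : IQ) (a : S), (P.f l).toFun a = ((p.f l).toFun a).1) →
      (∀ (l : IQ) (a : S), (Q.f l).toFun a = ((q.f l).toFun a).1) →
      (PathLE P Q ↔ PathLE p q) :=
    fun _ _ _ _ => pathLE_iff_of_coe_eq hwb
  have hpush : ∀ p q : CuPath S T',
      PathLE (p.postcomp _ hι) (q.postcomp _ hι) ↔ PathLE p q :=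
    fun p q => hle p q _ _ (fun _ _ => rfl) (fun _ _ => rfl)
  refine ⟨fun p => ⟨p.postcomp _ hι, fun _ _ => rfl⟩, hle,
    Quotient.map (CuPath.postcomp _ hι)
      (fun p q h => ⟨(hpush p q).2 h.1, (hpush q p).2 h.2⟩), fun p P hP => ?_, ?_⟩
  · exact Quotient.sound ⟨(hle p p _ P (fun _ _ => rfl) hP).2 (PathLE.refl p),
      (hle p p P _ hP (fun _ _ => rfl)).2 (PathLE.refl p)⟩
  · rintro ⟨p⟩ ⟨q⟩
    exact hpush p q
end

section
/- Let S and T be Cu-semigroups, and let J be an ideal of T. Then the map ι_*: ⟦S,J⟧ → ⟦S,T⟧ induced by the inclusion ι: J → T is an order-embedding whose image is an ideal of ⟦S,T⟧. Moreover, an element x ∈ ⟦S,T⟧ belongs to the image of ι_* if and only if for some (equivalently, for every) path (f_λ)_λ representing x, each f_λ takes all its values in J. -/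
/-! ### Upper bounds of increasing sequences of paths -/

instance : DenselyOrdered IQ := inferInstanceAs (DenselyOrdered (Set.Ioo (0 : ℚ) 1))

instance : NoMaxOrder IQ := inferInstanceAs (NoMaxOrder (Set.Ioo (0 : ℚ) 1))

instance : NoMinOrder IQ := inferInstanceAs (NoMinOrder (Set.Ioo (0 : ℚ) 1))

instance : Nonempty IQ := ⟨⟨1 / 2, by norm_num, by norm_num⟩⟩

/-- The affine reparametrization of `ℚ ∩ (0,1)` onto the rational interval `(l, r)`. -/
def IQ.affine (l r : IQ) (h : l.1 < r.1) (q : IQ) : IQ :=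
  ⟨l.1 + (r.1 - l.1) * q.1, by
    have := mul_pos (sub_pos.2 h) q.2.1
    linarith [l.2.1], by
    have := mul_lt_mul_of_pos_left q.2.2 (sub_pos.2 h)
    linarith [r.2.2]⟩

theorem IQ.lt_affine (l r : IQ) (h : l.1 < r.1) (q : IQ) : l.1 < (IQ.affine l r h q).1 := by
  have := mul_pos (sub_pos.2 h) q.2.1
  simp only [IQ.affine]
  linarith

theorem IQ.affine_lt (l r : IQ) (h : l.1 < r.1) (q : IQ) : (IQ.affine l r h q).1 < r.1 := by
  have := mul_lt_mul_of_pos_left q.2.2 (sub_pos.2 h)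
  simp only [IQ.affine]
  linarith

theorem IQ.affine_strictMono (l r : IQ) (h : l.1 < r.1) {q q' : IQ} (hq : q.1 < q'.1) :
    (IQ.affine l r h q).1 < (IQ.affine l r h q').1 := by
  have := mul_lt_mul_of_pos_left hq (sub_pos.2 h)
  simp only [IQ.affine]
  linarith

/-- A countable type with a directed relation has a cofinal increasing sequence. -/
theorem exists_cofinal_seq {X : Type*} [Countable X] [Nonempty X] {R : X → X → Prop}
    (hR : ∀ x y, ∃ z, R x z ∧ R y z) :
    ∃ x : ℕ → X, (∀ n, R (x n) (x (n + 1))) ∧ ∀ y, ∃ n, R y (x n) := by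
  obtain ⟨u, hu⟩ := exists_surjective_nat X
  choose z hz₁ hz₂ using hR
  refine ⟨Nat.rec (u 0) fun n x => z x (u n), fun n => hz₁ _ _, fun y => ?_⟩
  obtain ⟨n, rfl⟩ := hu y
  exact ⟨n + 1, hz₂ _ _⟩

/-- Every increasing sequence of paths has an upper bound. -/
theorem CuPath.exists_upperBound {S T : Type*} [AddCommMonoid S] [PartialOrder S]
    [AddCommMonoid T] [PartialOrder T] [CuSemigroup S] (p : ℕ → CuPath S T)
    (hp : ∀ m n, m ≤ n → PathLE (p m) (p n)) : ∃ q : CuPath S T, ∀ n, PathLE (p n) q := by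
  obtain ⟨x, hx, hcof⟩ := exists_cofinal_seq (X := ℕ × IQ)
    (R := fun x y => ∃ r : IQ, x.2.1 < r.1 ∧ Prec ((p x.1).f r) ((p y.1).f y.2)) (by
      rintro ⟨k, l⟩ ⟨k', l'⟩
      obtain ⟨r, hr⟩ := IQ.exists_gt l
      obtain ⟨r', hr'⟩ := IQ.exists_gt l'
      obtain ⟨m, hm⟩ := hp k (max k k') (le_max_left _ _) r
      obtain ⟨m', hm'⟩ := hp k' (max k k') (le_max_right _ _) r'
      obtain ⟨t, ht, ht'⟩ := IQ.exists_gt₂ m m'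
      exact ⟨(max k k', t), ⟨r, hr, hm.trans ((p _).prec m t ht)⟩,
        ⟨r', hr', hm'.trans ((p _).prec m' t ht')⟩⟩)
  choose r hr hrx using hx
  have hlt : ∀ n m, n + 1 ≤ m → Prec ((p (x n).1).f (r n)) ((p (x m).1).f (x m).2) := by
    intro n m hnm
    induction m, hnm using Nat.le_induction with
    | base => exact hrx n
    | succ m _ ih => exact (ih.trans ((p _).prec _ _ (hr m))).trans (hrx m)
  have : Countable (ℕ ×ₗ IQ) := inferInstanceAs (Countable (ℕ × IQ))
  obtain ⟨e⟩ := Order.iso_of_countable_dense IQ (ℕ ×ₗ IQ)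
  let g : ℕ ×ₗ IQ → GenCuMor S T := fun y =>
    (p (x (ofLex y).1).1).f (IQ.affine (x (ofLex y).1).2 (r (ofLex y).1) (hr _) (ofLex y).2)
  have hg : ∀ y z : ℕ ×ₗ IQ, y < z → Prec (g y) (g z) := by
    intro y z hyz
    obtain ⟨⟨n, a⟩, rfl⟩ := toLex.surjective y
    obtain ⟨⟨m, b⟩, rfl⟩ := toLex.surjective z
    rcases Prod.Lex.toLex_lt_toLex.1 hyz with h | ⟨h, h'⟩
    · exact (((p _).prec _ _ (IQ.affine_lt _ _ (hr n) a)).trans (hlt n m h)).trans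
        ((p _).prec _ _ (IQ.lt_affine _ _ (hr m) b))
    · obtain rfl : n = m := h
      exact (p _).prec _ _ (IQ.affine_strictMono _ _ (hr n) h')
  refine ⟨⟨fun l => g (e l), fun l m h => hg _ _ (e.strictMono h)⟩, fun k l => ?_⟩
  obtain ⟨n, s, hs, hsn⟩ := hcof (k, l)
  obtain ⟨a⟩ := (inferInstance : Nonempty IQ)
  refine ⟨e.symm (toLex (n, a)), ?_⟩
  simp only [OrderIso.apply_symm_apply]
  exact (((p k).prec _ _ hs).trans hsn).trans ((p _).prec _ _ (IQ.lt_affine _ _ (hr n) a))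

/-- Every increasing sequence in `⟦S,T⟧` is bounded above. -/
theorem BivCu.bddAbove_range {S T : Type*} [AddCommMonoid S] [PartialOrder S]
    [AddCommMonoid T] [PartialOrder T] [CuSemigroup S] (d : ℕ → BivCu S T) (hd : Monotone d) :
    BddAbove (Set.range d) := by
  choose p hp using fun n => Quotient.exists_rep (d n)
  obtain ⟨q, hq⟩ := CuPath.exists_upperBound p fun m n hmn => by
    have h := hd hmn
    rw [← hp m, ← hp n] at h
    exact h
  refine ⟨mk q, ?_⟩
  rintro _ ⟨n, rfl⟩
  rw [← hp n]
  exact hq n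

section Ideal

variable {S T : Type*} [AddCommMonoid S] [PartialOrder S] [AddCommMonoid T] [PartialOrder T]
  {J : AddSubmonoid T}

theorem isLUB_of_isLUB_coe {c : ℕ → J} {s : J}
    (h : IsLUB (Set.range fun n => (c n : T)) (s : T)) : IsLUB (Set.range c) s := by
  refine ⟨?_, fun b hb => h.2 ?_⟩
  · rintro _ ⟨n, rfl⟩
    exact h.1 ⟨n, rfl⟩
  · rintro _ ⟨n, rfl⟩
    exact hb ⟨n, rfl⟩

theorem isLUB_coe [CuSemigroup T]
    (hsup : ∀ c : ℕ → T, Monotone c → (∀ n, c n ∈ J) → ∀ s : T, IsLUB (Set.range c) s → s ∈ J)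
    {c : ℕ → J} (hc : Monotone c) {s : J} (h : IsLUB (Set.range c) s) :
    IsLUB (Set.range fun n => (c n : T)) (s : T) := by
  obtain ⟨t, ht⟩ := CuSemigroup.O1 (fun n => (c n : T)) fun _ _ hmn => hc hmn
  have htJ : t ∈ J := hsup _ (fun _ _ hmn => hc hmn) (fun n => (c n).2) t ht
  obtain rfl : s = ⟨t, htJ⟩ := h.unique (isLUB_of_isLUB_coe (s := ⟨t, htJ⟩) ht)
  exact ht

theorem wayBelow_coe_iff [CuSemigroup T] (hdown : ∀ a b : T, b ≤ a → a ∈ J → b ∈ J)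
    (hsup : ∀ c : ℕ → T, Monotone c → (∀ n, c n ∈ J) → ∀ s : T, IsLUB (Set.range c) s → s ∈ J)
    {a b : J} : WayBelow (a : T) (b : T) ↔ WayBelow a b := by
  constructor
  · intro h c hc s hs hbs
    exact h (fun n => (c n : T)) (fun _ _ hmn => hc hmn) s (isLUB_coe hsup hc hs) hbs
  · intro h
    obtain ⟨c, hc, hlub⟩ := CuSemigroup.O2 (b : T)
    have hcJ : ∀ n, c n ∈ J := fun n => hdown _ _ (hlub.1 ⟨n, rfl⟩) b.2
    obtain ⟨n, hn⟩ := h (fun n => ⟨c n, hcJ n⟩)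
      (monotone_nat_of_le_succ fun n => (hc n).le) b (isLUB_of_isLUB_coe hlub) le_rfl
    have hn' : (a : T) ≤ c n := hn
    exact ((hc n).of_le_left hn').of_le_right (hlub.1 ⟨n + 1, rfl⟩)

/-- The inclusion of an ideal, as a generalized Cu-morphism. -/
def GenCuMor.incl [CuSemigroup T]
    (hsup : ∀ c : ℕ → T, Monotone c → (∀ n, c n ∈ J) → ∀ s : T, IsLUB (Set.range c) s → s ∈ J) :
    GenCuMor J T where
  toFun := Subtype.val
  map_zero' := rfl
  map_add' _ _ := rfl
  mono' _ _ h := h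
  map_sup' _ _ hc hs := isLUB_coe hsup hc hs

/-- A generalized Cu-morphism with values in `J`, as a morphism into `J`. -/
def GenCuMor.codRestrict (f : GenCuMor S T) (hf : ∀ a, f.toFun a ∈ J) : GenCuMor S J where
  toFun a := ⟨f.toFun a, hf a⟩
  map_zero' := Subtype.ext f.map_zero'
  map_add' a b := Subtype.ext (f.map_add' a b)
  mono' _ _ h := f.mono' h
  map_sup' c s hc hs := isLUB_of_isLUB_coe (f.map_sup' c s hc hs)

theorem PathLE.mem_of_mem [CuSemigroup S] (hdown : ∀ a b : T, b ≤ a → a ∈ J → b ∈ J)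
    {p q : CuPath S T} (h : PathLE p q) (hq : ∀ l a, (q.f l).toFun a ∈ J) (l : IQ) (a : S) :
    (p.f l).toFun a ∈ J := by
  obtain ⟨m, hm⟩ := h l
  exact hdown _ _ (hm.le a) (hq m a)

theorem prec_incl_comp_iff [CuSemigroup T] (hdown : ∀ a b : T, b ≤ a → a ∈ J → b ∈ J)
    (hsup : ∀ c : ℕ → T, Monotone c → (∀ n, c n ∈ J) → ∀ s : T, IsLUB (Set.range c) s → s ∈ J)
    {f g : GenCuMor S J} :
    Prec ((GenCuMor.incl hsup).comp f) ((GenCuMor.incl hsup).comp g) ↔ Prec f g :=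
  forall₃_congr fun _ _ _ => wayBelow_coe_iff hdown hsup

variable [CuSemigroup T] (hdown : ∀ a b : T, b ≤ a → a ∈ J → b ∈ J)
  (hsup : ∀ c : ℕ → T, Monotone c → (∀ n, c n ∈ J) → ∀ s : T, IsLUB (Set.range c) s → s ∈ J)

/-- The path in `T` obtained from a path in `J`. -/
def CuPath.incl (p : CuPath S J) : CuPath S T where
  f l := (GenCuMor.incl hsup).comp (p.f l)
  prec l m h := (prec_incl_comp_iff hdown hsup).2 (p.prec l m h)

theorem pathLE_incl_iff {p q : CuPath S J} :
    PathLE (p.incl hdown hsup) (q.incl hdown hsup) ↔ PathLE p q :=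
  forall_congr' fun _ => exists_congr fun _ => prec_incl_comp_iff hdown hsup

theorem CuPath.exists_incl_eq (p : CuPath S T) (hp : ∀ l a, (p.f l).toFun a ∈ J) :
    ∃ q : CuPath S J, q.incl hdown hsup = p :=
  ⟨⟨fun l => (p.f l).codRestrict (hp l), fun l m h a b hab =>
    (wayBelow_coe_iff hdown hsup).1 (p.prec l m h a b hab)⟩, rfl⟩

/-- The map `⟦S,J⟧ → ⟦S,T⟧` induced by the inclusion. -/
def BivCu.incl [CuSemigroup S] : BivCu S J → BivCu S T :=
  Quotient.map (CuPath.incl hdown hsup) fun _ _ h =>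
    ⟨(pathLE_incl_iff hdown hsup).2 h.1, (pathLE_incl_iff hdown hsup).2 h.2⟩

theorem BivCu.incl_le_incl [CuSemigroup S] {x y : BivCu S J} :
    BivCu.incl hdown hsup x ≤ BivCu.incl hdown hsup y ↔ x ≤ y := by
  obtain ⟨p, rfl⟩ := Quotient.exists_rep x
  obtain ⟨q, rfl⟩ := Quotient.exists_rep y
  exact pathLE_incl_iff hdown hsup

theorem BivCu.mk_mem_range_incl [CuSemigroup S] {p : CuPath S T} :
    BivCu.mk p ∈ Set.range (BivCu.incl (S := S) hdown hsup) ↔ ∀ l a, (p.f l).toFun a ∈ J := by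
  constructor
  · rintro ⟨x, hx⟩
    obtain ⟨q, rfl⟩ := Quotient.exists_rep x
    exact PathLE.mem_of_mem hdown (Quotient.exact hx).2 fun l a => ((q.f l).toFun a).2
  · intro hp
    obtain ⟨q, rfl⟩ := p.exists_incl_eq hdown hsup hp
    exact ⟨mk q, rfl⟩

theorem BivCu.mem_range_incl_of_le [CuSemigroup S] {x y : BivCu S T} (h : y ≤ x)
    (hx : x ∈ Set.range (BivCu.incl (S := S) hdown hsup)) :
    y ∈ Set.range (BivCu.incl (S := S) hdown hsup) := by
  obtain ⟨p, rfl⟩ := Quotient.exists_rep x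
  obtain ⟨q, rfl⟩ := Quotient.exists_rep y
  exact (mk_mem_range_incl hdown hsup).2
    (PathLE.mem_of_mem hdown h ((mk_mem_range_incl hdown hsup).1 hx))

theorem BivCu.incl_add [CuSemigroup S] [CuSemigroup J] (x y : BivCu S J) :
    incl hdown hsup (x + y) = incl hdown hsup x + incl hdown hsup y := by
  obtain ⟨p, rfl⟩ := Quotient.exists_rep x
  obtain ⟨q, rfl⟩ := Quotient.exists_rep y
  rfl

theorem BivCu.isCuIdeal_range_incl [CuSemigroup S] [CuSemigroup J] :
    IsCuIdeal (Set.range (BivCu.incl (S := S) hdown hsup)) := by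
  refine ⟨⟨0, rfl⟩, ?_, fun x y h hx => mem_range_incl_of_le hdown hsup h hx, ?_⟩
  · rintro _ _ ⟨x, rfl⟩ ⟨y, rfl⟩
    exact ⟨x + y, incl_add hdown hsup x y⟩
  · intro c hc hcJ s hs
    choose d hd using hcJ
    obtain ⟨b, hb⟩ := BivCu.bddAbove_range d fun m n hmn => by
      rw [← incl_le_incl hdown hsup, hd, hd]
      exact hc hmn
    refine mem_range_incl_of_le hdown hsup (hs.2 ?_) ⟨b, rfl⟩
    rintro _ ⟨n, rfl⟩
    rw [← hd n]
    exact (incl_le_incl hdown hsup).2 (hb ⟨n, rfl⟩)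

end Ideal

/-- For an ideal `J` of `T`, the inclusion `ι : J → T` induces an
order-embedding `ι_* : ⟦S,J⟧ → ⟦S,T⟧` whose image is an ideal of `⟦S,T⟧`; an element of
`⟦S,T⟧` lies in the image iff for some (equivalently, every) representing path all the
morphisms of the path take values in `J`. -/
theorem bivariant_ideal_second_entry
    (S T : Type*) [AddCommMonoid S] [PartialOrder S] [AddCommMonoid T] [PartialOrder T]
    [CuSemigroup S] [CuSemigroup T] (J : AddSubmonoid T) [CuSemigroup J]
    (hdown : ∀ a b : T, b ≤ a → a ∈ J → b ∈ J)
    (hsup : ∀ c : ℕ → T, Monotone c → (∀ n, c n ∈ J) → ∀ s : T, IsLUB (Set.range c) s → s ∈ J) :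
    (∀ p : CuPath S J, ∃ P : CuPath S T, ∀ (l : IQ) (a : S),
        (P.f l).toFun a = ((p.f l).toFun a).1) ∧
    (∃ F : BivCu S J → BivCu S T,
      (∀ (p : CuPath S J) (P : CuPath S T),
        (∀ (l : IQ) (a : S), (P.f l).toFun a = ((p.f l).toFun a).1) →
        F (BivCu.mk p) = BivCu.mk P) ∧
      (F 0 = 0 ∧ ∀ x y : BivCu S J, F (x + y) = F x + F y) ∧
      (∀ x y : BivCu S J, F x ≤ F y ↔ x ≤ y) ∧
      IsCuIdeal (Set.range F) ∧
      (∀ x : BivCu S T,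
        (x ∈ Set.range F ↔ ∃ p : CuPath S T, BivCu.mk p = x ∧
            ∀ (l : IQ) (a : S), (p.f l).toFun a ∈ J) ∧
        (x ∈ Set.range F ↔ ∀ p : CuPath S T, BivCu.mk p = x →
            ∀ (l : IQ) (a : S), (p.f l).toFun a ∈ J))) := by
  refine ⟨fun p => ⟨p.incl hdown hsup, fun _ _ => rfl⟩, BivCu.incl hdown hsup, ?_,
    ⟨rfl, BivCu.incl_add hdown hsup⟩, fun _ _ => BivCu.incl_le_incl hdown hsup,
    BivCu.isCuIdeal_range_incl hdown hsup, fun x => ⟨⟨fun hx => ?_, ?_⟩, ?_, fun h => ?_⟩⟩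
  · intro p P h
    exact congrArg BivCu.mk (CuPath.ext' (funext fun l =>
      GenCuMor.ext' (funext fun a => (h l a).symm)))
  · obtain ⟨p, rfl⟩ := Quotient.exists_rep x
    exact ⟨p, rfl, (BivCu.mk_mem_range_incl hdown hsup).1 hx⟩
  · rintro ⟨p, rfl, hp⟩
    exact (BivCu.mk_mem_range_incl hdown hsup).2 hp
  · rintro hx p rfl
    exact (BivCu.mk_mem_range_incl hdown hsup).1 hx
  · obtain ⟨p, rfl⟩ := Quotient.exists_rep x
    exact (BivCu.mk_mem_range_incl hdown hsup).2 (h p rfl)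
end

section
/- Let S and T be Cu-semigroups and let J be an ideal of S. Then the set K of all x ∈ ⟦S,T⟧ such that for some (equivalently, for every) path (f_λ)_λ representing x, each f_λ vanishes on J (i.e. f_λ(a) = 0 for all a ∈ J), is an ideal of ⟦S,T⟧; in particular, membership of x in K for some representing path implies it for every representing path. -/
theorem WayBelow.eq_zero {T : Type*} [AddCommMonoid T] [PartialOrder T] [CuSemigroup T] {a : T}
    (h : WayBelow a 0) : a = 0 :=
  le_antisymm h.le (CuSemigroup.zero_le' a)

/-- If `f ≺ g` and `g` vanishes on a downward-hereditary set, then so does `f`. -/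
theorem Prec.eq_zero_of_eq_zero {S T : Type*} [AddCommMonoid S] [PartialOrder S] [AddCommMonoid T]
    [PartialOrder T] [CuSemigroup S] [CuSemigroup T] {f g : GenCuMor S T} (h : Prec f g)
    {J : Set S} (hdown : ∀ a b : S, b ≤ a → a ∈ J → b ∈ J) (hg : ∀ a ∈ J, g.toFun a = 0)
    {a : S} (ha : a ∈ J) : f.toFun a = 0 := by
  obtain ⟨c, hc, hlub⟩ := CuSemigroup.O2 a
  have hsup := f.map_sup' c a (monotone_nat_of_le_succ fun n => (hc n).le) hlub
  refine le_antisymm (hsup.2 ?_) (CuSemigroup.zero_le' _)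
  rintro _ ⟨n, rfl⟩
  have hn := h _ _ (hc n)
  rw [hg _ (hdown a _ (hlub.1 (Set.mem_range_self _)) ha)] at hn
  exact hn.le

/-- A path below a path vanishing on a downward-hereditary set vanishes on that set. -/
theorem PathLE.eq_zero_of_eq_zero {S T : Type*} [AddCommMonoid S] [PartialOrder S]
    [AddCommMonoid T] [PartialOrder T] [CuSemigroup S] [CuSemigroup T] {p q : CuPath S T}
    (h : PathLE p q) {J : Set S} (hdown : ∀ a b : S, b ≤ a → a ∈ J → b ∈ J)
    (hq : ∀ (l : IQ), ∀ a ∈ J, (q.f l).toFun a = 0) (l : IQ) {a : S} (ha : a ∈ J) :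
    (p.f l).toFun a = 0 := by
  obtain ⟨m, hm⟩ := h l
  exact hm.eq_zero_of_eq_zero hdown (hq m) ha

section Concatenation

variable {S T : Type*} [AddCommMonoid S] [PartialOrder S] [AddCommMonoid T] [PartialOrder T]

theorem PathLE.eventually_prec [CuSemigroup S] {p q : CuPath S T} (h : PathLE p q) (l : IQ) :
    ∀ᶠ m in Filter.atTop, Prec (p.f l) (q.f m) := by
  obtain ⟨m, hm⟩ := h l
  filter_upwards [Filter.eventually_ge_atTop m] with r hr
  rcases hr.eq_or_lt with rfl | hr
  · exact hm
  · exact hm.trans (q.prec m r hr)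

/-- The affine reparametrization of `[0, 1)` onto `[a, b)` in `ℚ ∩ (0,1)`. -/
def IQ.lerp (a b : IQ) (hab : a.1 < b.1) (r : ℚ) (h0 : 0 ≤ r) (h1 : r < 1) : IQ :=
  ⟨a.1 + (b.1 - a.1) * r, by nlinarith [a.2.1], by nlinarith [b.2.2]⟩

theorem IQ.div_one_sub_nonneg (t : IQ) : 0 ≤ t.1 / (1 - t.1) :=
  div_nonneg t.2.1.le (by linarith [t.2.2])

theorem IQ.div_one_sub_lt {s t : IQ} (h : s.1 < t.1) : s.1 / (1 - s.1) < t.1 / (1 - t.1) := by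
  have hs : 0 < 1 - s.1 := by linarith [s.2.2]
  have ht : 0 < 1 - t.1 := by linarith [t.2.2]
  rw [div_lt_div_iff₀ hs ht]
  nlinarith

/-- The element of a sequence of paths, restricted to the intervals `[μ n, ν n)`, which sits at
position `x ∈ [0, ∞)` of their concatenation. -/
def CuPath.concatAt (q : ℕ → CuPath S T) (μ ν : ℕ → IQ) (hμν : ∀ n, (μ n).1 < (ν n).1) (x : ℚ) :
    GenCuMor S T :=
  (q ⌊x⌋₊).f (IQ.lerp (μ ⌊x⌋₊) (ν ⌊x⌋₊) (hμν _) (Int.fract x) (Int.fract_nonneg x)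
    (Int.fract_lt_one x))

theorem CuPath.concatAt_natCast (q : ℕ → CuPath S T) (μ ν : ℕ → IQ)
    (hμν : ∀ n, (μ n).1 < (ν n).1) (n : ℕ) :
    CuPath.concatAt q μ ν hμν n = (q n).f (μ n) := by
  simp [CuPath.concatAt, IQ.lerp]

theorem CuPath.concatAt_prec [CuSemigroup S] (q : ℕ → CuPath S T) (μ ν : ℕ → IQ)
    (hμν : ∀ n, (μ n).1 < (ν n).1) (hq : ∀ n, Prec ((q n).f (ν n)) ((q (n + 1)).f (μ (n + 1))))
    {x y : ℚ} (hx : 0 ≤ x) (hxy : x < y) :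
    Prec (CuPath.concatAt q μ ν hμν x) (CuPath.concatAt q μ ν hμν y) := by
  have hy : 0 ≤ y := hx.trans hxy.le
  have hstep : ∀ n, Prec ((q n).f (μ n)) ((q (n + 1)).f (μ (n + 1))) := fun n =>
    ((q n).prec _ _ (hμν n)).trans (hq n)
  have hfx : x = ⌊x⌋₊ + Int.fract x := by
    rw [natCast_floor_eq_intCast_floor hx, Int.floor_add_fract]
  have hfy : y = ⌊y⌋₊ + Int.fract y := by
    rw [natCast_floor_eq_intCast_floor hy, Int.floor_add_fract]
  rcases (Nat.floor_mono hxy.le).eq_or_lt with h | h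
  · have hfract : Int.fract x < Int.fract y := by
      rw [h] at hfx
      linarith
    have hlerp : ∀ (m n : ℕ) (r s : ℚ) (hr₀ : 0 ≤ r) (hr₁ : r < 1) (hs₀ : 0 ≤ s) (hs₁ : s < 1),
        m = n → r < s → Prec ((q m).f (IQ.lerp (μ m) (ν m) (hμν m) r hr₀ hr₁))
          ((q n).f (IQ.lerp (μ n) (ν n) (hμν n) s hs₀ hs₁)) := by
      rintro m _ r s _ _ _ _ rfl hrs
      refine (q m).prec _ _ ?_
      have := hμν m
      simp only [IQ.lerp]
      nlinarith
    exact hlerp _ _ _ _ _ _ _ _ h hfract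
  · have hxν : Prec (CuPath.concatAt q μ ν hμν x) ((q ⌊x⌋₊).f (ν ⌊x⌋₊)) := by
      refine (q _).prec _ _ ?_
      have := hμν ⌊x⌋₊
      simp only [IQ.lerp]
      nlinarith [Int.fract_lt_one x]
    have hxμ : Prec (CuPath.concatAt q μ ν hμν x) ((q ⌊y⌋₊).f (μ ⌊y⌋₊)) :=
      Nat.le_induction (hxν.trans (hq _)) (fun n _ ih => ih.trans (hstep n)) _ h
    rcases (Int.fract_nonneg y).eq_or_lt with h0 | h0
    · have hyn : y = (⌊y⌋₊ : ℚ) := by linarith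
      rw [hyn, CuPath.concatAt_natCast]
      exact hxμ
    · refine hxμ.trans ((q _).prec _ _ ?_)
      have := hμν ⌊y⌋₊
      simp only [IQ.lerp]
      nlinarith

/-- The concatenation of a sequence of paths, restricted to the intervals `[μ n, ν n)`. -/
def CuPath.concat [CuSemigroup S] (q : ℕ → CuPath S T) (μ ν : ℕ → IQ)
    (hμν : ∀ n, (μ n).1 < (ν n).1)
    (hq : ∀ n, Prec ((q n).f (ν n)) ((q (n + 1)).f (μ (n + 1)))) : CuPath S T where
  f t := CuPath.concatAt q μ ν hμν (t.1 / (1 - t.1))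
  prec s _ h := CuPath.concatAt_prec q μ ν hμν hq s.div_one_sub_nonneg (IQ.div_one_sub_lt h)

/-- An increasing sequence of paths has an upper bound, each of whose entries is an entry of
one of the given paths. -/
theorem CuPath.exists_upper_bound [CuSemigroup S] (q : ℕ → CuPath S T)
    (hq : ∀ k n, k ≤ n → PathLE (q k) (q n)) :
    ∃ u : CuPath S T, (∀ n, PathLE (q n) u) ∧ ∀ t, ∃ n l, u.f t = (q n).f l := by
  obtain ⟨e, he⟩ := exists_surjective_nat IQ
  choose next hnext using IQ.exists_gt
  have hex : ∀ (n : ℕ) (m : IQ), ∃ r : IQ, Prec ((q n).f m) ((q (n + 1)).f r) ∧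
      ∀ k ∈ Finset.range (n + 1), ∀ j ∈ Finset.range (n + 1),
        Prec ((q k).f (e j)) ((q (n + 1)).f r) := by
    intro n m
    refine (((hq n (n + 1) n.le_succ).eventually_prec m).and ?_).exists
    simp only [Filter.eventually_all_finset]
    intro k hk j _
    exact (hq k (n + 1) (Finset.mem_range.1 hk).le).eventually_prec (e j)
  choose F hF₁ hF₂ using hex
  let μ : ℕ → IQ := fun n => Nat.rec (e 0) (fun n m => F n (next m)) n
  let ν : ℕ → IQ := fun n => next (μ n)
  refine ⟨CuPath.concat q μ ν (fun n => hnext (μ n)) (fun n => hF₁ n (ν n)), ?_,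
    fun _ => ⟨_, _, rfl⟩⟩
  intro k l
  obtain ⟨j, rfl⟩ := he l
  set n := max k j
  have hpos : (0 : ℚ) < (n : ℚ) + 1 := by positivity
  have hpos' : (0 : ℚ) < (n : ℚ) + 2 := by positivity
  refine ⟨⟨((n : ℚ) + 1) / (n + 2), div_pos hpos hpos', ?_⟩, ?_⟩
  · rw [div_lt_one hpos']
    linarith
  · have hval : ((n : ℚ) + 1) / (n + 2) / (1 - ((n : ℚ) + 1) / (n + 2)) = ((n + 1 : ℕ) : ℚ) := by
      have h1 : 1 - ((n : ℚ) + 1) / (n + 2) = 1 / (n + 2) := by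
        field_simp
        ring
      rw [h1]
      push_cast
      field_simp
    simp only [CuPath.concat]
    rw [hval, CuPath.concatAt_natCast]
    exact hF₂ n (ν n) k (Finset.mem_range.2 (Nat.lt_succ_of_le (le_max_left _ _))) j
      (Finset.mem_range.2 (Nat.lt_succ_of_le (le_max_right _ _)))

end Concatenation

/-- For an ideal `J` of `S`, the set of elements of `⟦S,T⟧` admitting a
representing path all of whose morphisms vanish on `J` is an ideal of `⟦S,T⟧`; moreover,
if some representing path vanishes on `J` then every representing path does. -/
theorem bivariant_ideal_first_entry
    (S T : Type*) [AddCommMonoid S] [PartialOrder S] [AddCommMonoid T] [PartialOrder T]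
    [CuSemigroup S] [CuSemigroup T] (J : AddSubmonoid S)
    (hdown : ∀ a b : S, b ≤ a → a ∈ J → b ∈ J)
    (hsup : ∀ c : ℕ → S, Monotone c → (∀ n, c n ∈ J) → ∀ s : S, IsLUB (Set.range c) s → s ∈ J) :
    (∀ x : BivCu S T,
      (∃ p : CuPath S T, BivCu.mk p = x ∧ ∀ (l : IQ) (a : S), a ∈ J → (p.f l).toFun a = 0) ↔
      (∀ p : CuPath S T, BivCu.mk p = x → ∀ (l : IQ) (a : S), a ∈ J → (p.f l).toFun a = 0)) ∧
    IsCuIdeal {x : BivCu S T |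
      ∃ p : CuPath S T, BivCu.mk p = x ∧ ∀ (l : IQ) (a : S), a ∈ J → (p.f l).toFun a = 0} := by
  have hmem : ∀ p q : CuPath S T, PathLE p q →
      (∀ (l : IQ) (a : S), a ∈ J → (q.f l).toFun a = 0) →
      ∀ (l : IQ) (a : S), a ∈ J → (p.f l).toFun a = 0 :=
    fun p q h hq l a ha => h.eq_zero_of_eq_zero (J := (J : Set S)) hdown hq l ha
  have hex : ∀ x : BivCu S T, ∃ p : CuPath S T, BivCu.mk p = x := Quotient.exists_rep
  refine ⟨fun x => ⟨?_, fun h => ?_⟩, ?_, ?_, ?_, ?_⟩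
  · rintro ⟨p, rfl, hp⟩ q hq
    exact hmem q p (BivCu.mk_le_mk.1 hq.le) hp
  · obtain ⟨p, hp⟩ := hex x
    exact ⟨p, hp, h p hp⟩
  · exact ⟨CuPath.zero S T, rfl, fun _ _ _ => rfl⟩
  · rintro _ _ ⟨p, rfl, hp⟩ ⟨q, rfl, hq⟩
    refine ⟨p.add q, rfl, fun l a ha => ?_⟩
    show (p.f l).toFun a + (q.f l).toFun a = 0
    rw [hp l a ha, hq l a ha, add_zero]
  · rintro _ y hy ⟨p, rfl, hp⟩
    obtain ⟨q, rfl⟩ := hex y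
    exact ⟨q, rfl, hmem q p (BivCu.mk_le_mk.1 hy) hp⟩
  · intro c hc hcJ s hs
    choose q hqc hq using hcJ
    obtain ⟨u, hu, huq⟩ := CuPath.exists_upper_bound q fun k n hkn =>
      BivCu.mk_le_mk.1 (by rw [hqc, hqc]; exact hc hkn)
    obtain ⟨p, rfl⟩ := hex s
    refine ⟨p, rfl, hmem p u (BivCu.mk_le_mk.1 (hs.2 ?_)) fun l a ha => ?_⟩
    · rintro _ ⟨n, rfl⟩
      rw [← hqc n]
      exact BivCu.mk_le_mk.2 (hu n)
    · obtain ⟨n, m, h⟩ := huq l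
      rw [h]
      exact hq n m a ha
end
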